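/- (Theorem 4, asymptotic form) Let σ > 0, let q be an odd integer with q ≥ 3, let p be an even integer with p > q, and fix a ∈ ℝ and b > 0. Let H(ε_q, ε_p) denote the differential entropy of the density p(x) = C(ε_q, ε_p) p_G(x) exp(ε_q x^q − ε_p x^p), and let H₁(ε) = log(√(2π) σ (1 − ε σ^p (p−1)!!)) + (1 − ε σ^p (p−1)!!)^{−1} · (1/2 + ε σ^p ((p−1)!! − (1/2)(p+1)!!)). Then H(t a, t b) − H₁(t b) = O(t²) as t → 0 from the right. In particular, the first-order entropy approximation is independent of the asymmetry parameter ε_q and coincides with the first-order approximation of the symmetric case. -/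

import Mathlib

open MeasureTheory Real Filter Topology Asymptotics

/-- The centered Gaussian density with standard deviation `σ`. -/
noncomputable def pG (σ x : ℝ) : ℝ :=
  (1 / (Real.sqrt (2 * Real.pi) * σ)) * Real.exp (-x ^ 2 / (2 * σ ^ 2))

/-- The normalization integral of the asymmetric perturbed density. -/
noncomputable def Za (σ : ℝ) (q p : ℕ) (εq εp : ℝ) : ℝ :=
  ∫ x : ℝ, pG σ x * Real.exp (εq * x ^ q - εp * x ^ p)

/-- The asymmetric perturbed density `p(x) = C(ε_q,ε_p) p_G(x) exp(ε_q x^q - ε_p x^p)`. -/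
noncomputable def pa (σ : ℝ) (q p : ℕ) (εq εp : ℝ) (x : ℝ) : ℝ :=
  (Za σ q p εq εp)⁻¹ * pG σ x * Real.exp (εq * x ^ q - εp * x ^ p)

/-- The differential entropy of the asymmetric perturbed density. -/
noncomputable def Ha (σ : ℝ) (q p : ℕ) (εq εp : ℝ) : ℝ :=
  -∫ x : ℝ, pa σ q p εq εp x * Real.log (pa σ q p εq εp x)

open Polynomial in
lemma aux_integrable_poly (σ : ℝ) (hσ : 0 < σ) (P : Polynomial ℝ) :
    Integrable (fun x : ℝ => P.eval x * pG σ x) := by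
  induction P using Polynomial.induction_on' with
  | add f g hf hg =>
    simp only [Polynomial.eval_add, add_mul]
    exact hf.add hg
  | monomial n c =>
    have h := integrable_rpow_mul_exp_neg_mul_sq (b := 1 / (2 * σ ^ 2)) (by positivity)
      (s := (n : ℝ)) (by have : (0:ℝ) ≤ n := Nat.cast_nonneg n
                         linarith)
    have h2 := h.const_mul (c * (1 / (Real.sqrt (2 * Real.pi) * σ)))
    refine h2.congr (Eventually.of_forall fun x => ?_)
    simp only [Polynomial.eval_monomial, pG, Real.rpow_natCast]
    rw [show -(1 / (2 * σ ^ 2)) * x ^ 2 = -x ^ 2 / (2 * σ ^ 2) by ring]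
    ring

lemma aux_int_pow (σ : ℝ) (hσ : 0 < σ) (n : ℕ) :
    Integrable (fun x : ℝ => x ^ n * pG σ x) := by
  simpa using aux_integrable_poly σ hσ (Polynomial.X ^ n)

lemma aux_pG_pos (σ : ℝ) (hσ : 0 < σ) (x : ℝ) : 0 < pG σ x := by
  unfold pG; positivity

lemma aux_pG_cont (σ : ℝ) : Continuous (pG σ) := by
  unfold pG; fun_prop

lemma aux_pG_one (σ : ℝ) (hσ : 0 < σ) : ∫ x : ℝ, pG σ x = 1 := by
  have h := integral_gaussian (1 / (2 * σ ^ 2))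
  unfold pG
  rw [integral_const_mul]
  have h2 : ∀ x : ℝ, -x ^ 2 / (2 * σ ^ 2) = -(1 / (2 * σ ^ 2)) * x ^ 2 := fun x => by ring
  simp_rw [h2]
  rw [h, show π / (1 / (2 * σ ^ 2)) = (2 * π) * σ ^ 2 by field_simp,
    Real.sqrt_mul (by positivity) (σ ^ 2), Real.sqrt_sq hσ.le]
  have : √(2 * π) ≠ 0 := by positivity
  field_simp

lemma aux_moment_rec (σ : ℝ) (hσ : 0 < σ) (n : ℕ) :
    ∫ x : ℝ, x ^ (n + 2) * pG σ x = σ ^ 2 * (n + 1) * ∫ x : ℝ, x ^ n * pG σ x := by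
  have hd : ∀ x : ℝ, HasDerivAt (fun x : ℝ => x ^ (n + 1) * pG σ x)
      ((n + 1) * (x ^ n * pG σ x) - (1 / σ ^ 2) * (x ^ (n + 2) * pG σ x)) x := by
    intro x
    have h1 : HasDerivAt (fun x : ℝ => -x ^ 2 / (2 * σ ^ 2)) (-(2 * x) / (2 * σ ^ 2)) x := by
      simpa using ((hasDerivAt_pow 2 x).neg.div_const (2 * σ ^ 2))
    have h2 := (h1.exp.const_mul (1 / (Real.sqrt (2 * Real.pi) * σ)))
    have h3 := (hasDerivAt_pow (n + 1) x).mul h2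
    refine h3.congr_deriv ?_
    simp only [pG, Nat.add_sub_cancel]
    push_cast
    have : √(2 * π) ≠ 0 := by positivity
    field_simp
    ring
  have h := integral_eq_zero_of_hasDerivAt_of_integrable hd
    (((aux_int_pow σ hσ n).const_mul _).sub ((aux_int_pow σ hσ (n + 2)).const_mul _))
    (aux_int_pow σ hσ (n + 1))
  rw [integral_sub ((aux_int_pow σ hσ n).const_mul _) ((aux_int_pow σ hσ (n + 2)).const_mul _),
    integral_const_mul, integral_const_mul] at h
  field_simp at h
  linarith

lemma aux_moment_odd (σ : ℝ) (n : ℕ) (hn : Odd n) : ∫ x : ℝ, x ^ n * pG σ x = 0 := by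
  have h := integral_neg_eq_self (fun x : ℝ => x ^ n * pG σ x) volume
  simp only [hn.neg_pow, pG, neg_mul, integral_neg, even_two.neg_pow] at h
  simp only [pG, neg_mul]
  linarith

lemma aux_moment_even (σ : ℝ) (hσ : 0 < σ) (m : ℕ) :
    ∫ x : ℝ, x ^ (2 * m) * pG σ x = σ ^ (2 * m) * (Nat.doubleFactorial (2 * m - 1) : ℝ) := by
  induction m with
  | zero => simp [aux_pG_one σ hσ]
  | succ k ih =>
    rw [show 2 * (k + 1) = 2 * k + 2 by ring, aux_moment_rec σ hσ, ih]
    have : Nat.doubleFactorial (2 * k + 2 - 1) = (2 * k + 1) * Nat.doubleFactorial (2 * k - 1) := by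
      rcases k with _ | k
      · simp
      · exact Nat.doubleFactorial_add_two (2 * k + 1)
    rw [this]
    push_cast
    ring

lemma aux_exp_bound {y M : ℝ} (hM : 0 ≤ M) (hy : y ≤ M) :
    |Real.exp y - 1 - y| ≤ Real.exp M * y ^ 2 := by
  have h1 : 1 ≤ Real.exp M := Real.one_le_exp hM
  have h2 : Real.exp y ≤ Real.exp M := Real.exp_le_exp.2 hy
  have h3 := Real.add_one_le_exp y
  have h4 := Real.add_one_le_exp (-y)
  have h5 : Real.exp y * Real.exp (-y) = 1 := by rw [← Real.exp_add]; simp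
  have h6 := Real.exp_pos y
  have h7 : Real.exp y - 1 ≤ y * Real.exp y := by nlinarith
  rw [abs_of_nonneg (by linarith)]
  rcases le_total 0 y with h | h
  · have : y * Real.exp y - y ≤ y * (Real.exp M * y) := by
      have : Real.exp y - 1 ≤ Real.exp M * y := by nlinarith
      nlinarith
    nlinarith
  · have : (-y) * (1 - Real.exp y) ≤ (-y) * (-y) := by
      apply mul_le_mul_of_nonneg_left <;> linarith
    nlinarith [sq_nonneg y]

lemma aux_u_bound (q p : ℕ) (hpe : Even p) (hqp : q < p) (a b : ℝ) (hb : 0 < b) :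
    ∃ M : ℝ, 0 ≤ M ∧ ∀ x : ℝ, a * x ^ q - b * x ^ p ≤ M := by
  set R := max 1 (|a| / b) with hR
  refine ⟨|a| * R ^ q, by positivity, fun x => ?_⟩
  have h1 : a * x ^ q ≤ |a| * |x| ^ q := by
    rw [← abs_pow, ← abs_mul]; exact le_abs_self _
  have h2 : x ^ p = |x| ^ p := (hpe.pow_abs x).symm
  have h0 := abs_nonneg x
  rw [h2]
  rcases le_total |x| R with h | h
  · have : |a| * |x| ^ q ≤ |a| * R ^ q := by gcongr
    have : 0 ≤ b * |x| ^ p := by positivity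
    linarith
  · have hx1 : 1 ≤ |x| := le_trans (le_max_left _ _) h
    have hx2 : |a| ≤ b * |x| := by
      have := le_trans (le_max_right _ _) h
      rw [div_le_iff₀ hb] at this
      linarith
    have h3 : |x| ^ (q + 1) ≤ |x| ^ p := pow_le_pow_right₀ hx1 hqp
    have h4 : |a| * |x| ^ q ≤ b * |x| * |x| ^ q := by gcongr
    have h5 : b * |x| ^ (q + 1) ≤ b * |x| ^ p := by gcongr
    have h6 : 0 ≤ |a| * R ^ q := by positivity
    rw [pow_succ] at h5
    nlinarith

lemma aux_int_exp (σ : ℝ) (hσ : 0 < σ) (U G : Polynomial ℝ) (M : ℝ) (hM : 0 ≤ M)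
    (hU : ∀ x, U.eval x ≤ M) (t : ℝ) (ht0 : 0 ≤ t) (ht1 : t ≤ 1) :
    Integrable (fun x : ℝ => G.eval x * (pG σ x * Real.exp (t * U.eval x))) := by
  have hG := aux_integrable_poly σ hσ G
  refine (hG.norm.mul_const (Real.exp M)).mono' ?_ (Eventually.of_forall fun x => ?_)
  · have := aux_pG_cont σ
    exact Continuous.aestronglyMeasurable (by fun_prop)
  · have h : t * U.eval x ≤ M := by
      have := hU x
      nlinarith
    have := Real.exp_le_exp.2 h
    rw [← mul_assoc, norm_mul, Real.norm_of_nonneg (Real.exp_pos _).le]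
    gcongr

lemma aux_expand (σ : ℝ) (hσ : 0 < σ) (U G : Polynomial ℝ) (M : ℝ) (hM : 0 ≤ M)
    (hU : ∀ x, U.eval x ≤ M) :
    (fun t : ℝ => (∫ x : ℝ, G.eval x * (pG σ x * Real.exp (t * U.eval x)))
      - ((∫ x : ℝ, G.eval x * pG σ x) + t * ∫ x : ℝ, (G * U).eval x * pG σ x))
      =O[𝓝[>] (0 : ℝ)] fun t => t ^ 2 := by
  refine IsBigO.of_bound (Real.exp M * ∫ x : ℝ, ‖(G * U ^ 2).eval x * pG σ x‖) ?_
  filter_upwards [Ioo_mem_nhdsGT (zero_lt_one' ℝ)] with t ht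
  have hI1 := aux_int_exp σ hσ U G M hM hU t ht.1.le ht.2.le
  have hI2 := aux_integrable_poly σ hσ G
  have hI3 := (aux_integrable_poly σ hσ (G * U)).const_mul t
  have hI4 := (aux_integrable_poly σ hσ (G * U ^ 2)).norm
  rw [← integral_const_mul, ← integral_add hI2 hI3, ← integral_sub hI1 (hI2.fun_add hI3)]
  have hb : ∀ x : ℝ, ‖G.eval x * (pG σ x * Real.exp (t * U.eval x))
      - (G.eval x * pG σ x + t * ((G * U).eval x * pG σ x))‖ ≤
      (Real.exp M * t ^ 2) * ‖(G * U ^ 2).eval x * pG σ x‖ := by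
    intro x
    have h : t * U.eval x ≤ M := by
      have := hU x
      have := ht.1
      have := ht.2
      nlinarith
    have h2 := aux_exp_bound hM h
    have h3 := abs_nonneg (G.eval x * pG σ x)
    have e1 : G.eval x * (pG σ x * Real.exp (t * U.eval x))
      - (G.eval x * pG σ x + t * ((G * U).eval x * pG σ x)) =
      (G.eval x * pG σ x) * (Real.exp (t * U.eval x) - 1 - t * U.eval x) := by
      simp only [Polynomial.eval_mul]; ring
    have e2 : (G * U ^ 2).eval x * pG σ x = (G.eval x * pG σ x) * (U.eval x) ^ 2 := by
      simp only [Polynomial.eval_mul, Polynomial.eval_pow]; ring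
    rw [e1, e2, norm_mul, norm_mul _ ((U.eval x) ^ 2), Real.norm_of_nonneg (sq_nonneg (U.eval x)),
      Real.norm_eq_abs (G.eval x * pG σ x), Real.norm_eq_abs (Real.exp _ - 1 - _)]
    calc _ ≤ |G.eval x * pG σ x| * (Real.exp M * (t * U.eval x) ^ 2) := by gcongr
      _ = _ := by ring
  calc _ ≤ ∫ x : ℝ, (Real.exp M * t ^ 2) * ‖(G * U ^ 2).eval x * pG σ x‖ :=
        norm_integral_le_of_norm_le (hI4.const_mul _) (Eventually.of_forall hb)
    _ = _ := by
        rw [integral_const_mul, Real.norm_of_nonneg (sq_nonneg t)]; ring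

lemma aux_Ha (σ : ℝ) (hσ : 0 < σ) (q p : ℕ) (a b t : ℝ) (U : Polynomial ℝ)
    (hUe : U = Polynomial.C a * Polynomial.X ^ q - Polynomial.C b * Polynomial.X ^ p)
    (M : ℝ) (hM : 0 ≤ M)
    (hU : ∀ x, U.eval x ≤ M) (ht0 : 0 ≤ t) (ht1 : t ≤ 1) (hZ : 0 < Za σ q p (t * a) (t * b)) :
    Ha σ q p (t * a) (t * b) = Real.log (Real.sqrt (2 * Real.pi) * σ) +
      (Real.log (Za σ q p (t * a) (t * b)) + (Za σ q p (t * a) (t * b))⁻¹ *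
        ((∫ x : ℝ, (Polynomial.C (1 / (2 * σ ^ 2)) * Polynomial.X ^ 2 : Polynomial ℝ).eval x *
          (pG σ x * Real.exp (t * U.eval x))) -
          t * ∫ x : ℝ, U.eval x * (pG σ x * Real.exp (t * U.eval x)))) := by
  have he : ∀ x : ℝ, t * a * x ^ q - t * b * x ^ p = t * U.eval x := by
    intro x; rw [hUe]; simp; ring
  have hI1 := aux_int_exp σ hσ U (Polynomial.C (1 / (2 * σ ^ 2)) * Polynomial.X ^ 2) M hM hU t ht0 ht1
  have hI2 := (aux_int_exp σ hσ U U M hM hU t ht0 ht1).const_mul t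
  have hI0 : Integrable (fun x : ℝ => pG σ x * Real.exp (t * U.eval x)) := by
    simpa using aux_int_exp σ hσ U 1 M hM hU t ht0 ht1
  set Z := Za σ q p (t * a) (t * b) with hZd
  have hZi : ∫ x : ℝ, pG σ x * Real.exp (t * U.eval x) = Z := by
    rw [hZd, Za]; simp only [he]
  set L := Real.log (Real.sqrt (2 * Real.pi) * σ) with hL
  have hpt : ∀ x : ℝ, pa σ q p (t * a) (t * b) x * Real.log (pa σ q p (t * a) (t * b) x) =
      (-Z⁻¹) * ((Real.log Z + L) * (pG σ x * Real.exp (t * U.eval x)) +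
        ((Polynomial.C (1 / (2 * σ ^ 2)) * Polynomial.X ^ 2 : Polynomial ℝ).eval x *
          (pG σ x * Real.exp (t * U.eval x)) -
          t * (U.eval x * (pG σ x * Real.exp (t * U.eval x))))) := by
    intro x
    have hlog : Real.log (pa σ q p (t * a) (t * b) x) =
        -Real.log Z - L - x ^ 2 / (2 * σ ^ 2) + t * U.eval x := by
      have hs : 0 < √(2 * π) * σ := by positivity
      rw [pa, he, ← hZd, pG, Real.log_mul (by positivity) (by positivity),
        Real.log_mul (by positivity) (by positivity), Real.log_mul (by positivity) (by positivity),
        Real.log_exp, Real.log_exp, Real.log_inv, one_div, Real.log_inv]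
      ring
    rw [hlog, pa, he, ← hZd]
    simp only [Polynomial.eval_mul, Polynomial.eval_C, Polynomial.eval_pow, Polynomial.eval_X]
    ring
  rw [Ha]
  simp_rw [hpt]
  have hI12 : Integrable (fun x : ℝ =>
      (Polynomial.C (1 / (2 * σ ^ 2)) * Polynomial.X ^ 2 : Polynomial ℝ).eval x *
          (pG σ x * Real.exp (t * U.eval x)) -
          t * (U.eval x * (pG σ x * Real.exp (t * U.eval x)))) := hI1.sub hI2
  rw [integral_const_mul, integral_add (hI0.const_mul _) hI12, integral_const_mul,
    integral_sub hI1 hI2, integral_const_mul, hZi]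
  field_simp
  ring

lemma aux_strict : HasStrictFDerivAt (fun z : ℝ × ℝ => Real.log z.1 + z.1⁻¹ * z.2)
    (fderiv ℝ (fun z : ℝ × ℝ => Real.log z.1 + z.1⁻¹ * z.2) (1, 1 / 2)) (1, 1 / 2) := by
  have h : ContDiffAt ℝ 1 (fun z : ℝ × ℝ => Real.log z.1 + z.1⁻¹ * z.2) (1, 1 / 2) := by
    refine ContDiffAt.add (contDiffAt_fst.log (by norm_num)) ?_
    exact (contDiffAt_fst.inv (by norm_num)).mul contDiffAt_snd
  exact h.hasStrictFDerivAt (by norm_num)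

theorem stmt15 (σ : ℝ) (hσ : 0 < σ)
    (q : ℕ) (hq : 3 ≤ q) (hqo : Odd q)
    (p : ℕ) (hpe : Even p) (hqp : q < p)
    (a : ℝ) (b : ℝ) (hb : 0 < b)
    (H₁ : ℝ → ℝ) (hH₁ : ∀ ε : ℝ, H₁ ε =
      Real.log (Real.sqrt (2 * Real.pi) * σ *
          (1 - ε * σ ^ p * (Nat.doubleFactorial (p - 1) : ℝ))) +
        (1 - ε * σ ^ p * (Nat.doubleFactorial (p - 1) : ℝ))⁻¹ *
          (1 / 2 + ε * σ ^ p * ((Nat.doubleFactorial (p - 1) : ℝ) -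
            (1 / 2) * (Nat.doubleFactorial (p + 1) : ℝ)))) :
    (fun t : ℝ => Ha σ q p (t * a) (t * b) - H₁ (t * b))
      =O[𝓝[>] (0 : ℝ)] fun t => t ^ 2 := by
  obtain ⟨m, hm⟩ := hpe.two_dvd
  obtain ⟨M, hM, hUM⟩ := aux_u_bound q p hpe hqp a b hb
  set U : Polynomial ℝ :=
    Polynomial.C a * Polynomial.X ^ q - Polynomial.C b * Polynomial.X ^ p with hUe
  have hU : ∀ x, U.eval x ≤ M := by
    intro x; simpa [hUe] using hUM x
  set D : ℝ := (Nat.doubleFactorial (p - 1) : ℝ) with hD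
  set D2 : ℝ := (Nat.doubleFactorial (p + 1) : ℝ) with hD2
  have mp : ∫ x : ℝ, x ^ p * pG σ x = σ ^ p * D := by
    rw [hD, hm]; exact aux_moment_even σ hσ m
  have mp2 : ∫ x : ℝ, x ^ (p + 2) * pG σ x = σ ^ (p + 2) * D2 := by
    have := aux_moment_even σ hσ (m + 1)
    rw [hD2, hm]
    exact this
  have mq := aux_moment_odd σ q hqo
  have mq2 := aux_moment_odd σ (q + 2) (hqo.add_even even_two)
  have m2 : ∫ x : ℝ, x ^ 2 * pG σ x = σ ^ 2 := by
    simpa using aux_moment_even σ hσ 1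
  have EU : ∫ x : ℝ, U.eval x * pG σ x = -(b * (σ ^ p * D)) := by
    have : ∀ x : ℝ, U.eval x * pG σ x = a * (x ^ q * pG σ x) - b * (x ^ p * pG σ x) := by
      intro x; simp [hUe]; ring
    simp_rw [this]
    rw [integral_sub ((aux_int_pow σ hσ _).const_mul _) ((aux_int_pow σ hσ _).const_mul _),
      integral_const_mul, integral_const_mul, mq, mp]
    ring
  set G : Polynomial ℝ := Polynomial.C (1 / (2 * σ ^ 2)) * Polynomial.X ^ 2 with hG
  have EG : ∫ x : ℝ, G.eval x * pG σ x = 1 / 2 := by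
    have : ∀ x : ℝ, G.eval x * pG σ x = (1 / (2 * σ ^ 2)) * (x ^ 2 * pG σ x) := by
      intro x; simp [hG]; ring
    simp_rw [this]
    rw [integral_const_mul, m2]
    field_simp
  have EGU : ∫ x : ℝ, (G * U).eval x * pG σ x = -(b * (σ ^ p * D2)) / 2 := by
    have : ∀ x : ℝ, (G * U).eval x * pG σ x =
        (a / (2 * σ ^ 2)) * (x ^ (q + 2) * pG σ x) - (b / (2 * σ ^ 2)) * (x ^ (p + 2) * pG σ x) := by
      intro x; simp [hG, hUe]; ring
    simp_rw [this]
    rw [integral_sub ((aux_int_pow σ hσ _).const_mul _) ((aux_int_pow σ hσ _).const_mul _),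
      integral_const_mul, integral_const_mul, mq2, mp2, pow_add]
    field_simp
    ring
  have x1 := aux_expand σ hσ U 1 M hM hU
  have xG := aux_expand σ hσ U G M hM hU
  have xU := aux_expand σ hσ U U M hM hU
  simp only [Polynomial.eval_one, one_mul, aux_pG_one σ hσ, EU] at x1
  rw [EG, EGU] at xG
  rw [EU] at xU
  set Z : ℝ → ℝ := fun t => Za σ q p (t * a) (t * b) with hZ
  have hZe : ∀ t, ∫ x : ℝ, pG σ x * Real.exp (t * U.eval x) = Z t := by
    intro t
    rw [hZ]
    simp only [Za]
    congr 1
    ext x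
    congr 2
    simp [hUe]; ring
  simp_rw [hZe] at x1
  set W : ℝ → ℝ := fun t => (∫ x : ℝ, G.eval x * (pG σ x * Real.exp (t * U.eval x))) -
          t * ∫ x : ℝ, U.eval x * (pG σ x * Real.exp (t * U.eval x)) with hW
  set Z1 : ℝ → ℝ := fun t => 1 - t * b * σ ^ p * D with hZ1
  set W1 : ℝ → ℝ := fun t => 1 / 2 + t * b * σ ^ p * (D - 1 / 2 * D2) with hW1
  have dZ : (fun t => Z t - Z1 t) =O[𝓝[>] (0 : ℝ)] fun t => t ^ 2 := by
    refine x1.congr_left fun t => ?_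
    simp only [hZ1]; ring
  have id0 : Tendsto (fun t : ℝ => t) (𝓝[>] 0) (𝓝 0) := tendsto_id.mono_left nhdsWithin_le_nhds
  have dW : (fun t => W t - W1 t) =O[𝓝[>] (0 : ℝ)] fun t => t ^ 2 := by
    have y1 : (fun t : ℝ => t) =O[𝓝[>] (0 : ℝ)] (fun _ => (1 : ℝ)) := id0.isBigO_one ℝ
    have y2 := y1.mul xU
    have y3 : (fun t : ℝ => t ^ 2 * ∫ x : ℝ, (U * U).eval x * pG σ x) =O[𝓝[>] (0 : ℝ)]
        fun t => t ^ 2 := by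
      simpa [mul_comm] using (isBigO_refl (fun t : ℝ => t ^ 2) (𝓝[>] (0 : ℝ))).const_mul_left
        (∫ x : ℝ, (U * U).eval x * pG σ x)
    simp only [one_mul] at y2
    refine ((xG.sub y2).sub y3).congr_left fun t => ?_
    simp only [hW, hW1]; ring
  have sq0 : Tendsto (fun t : ℝ => t ^ 2) (𝓝[>] 0) (𝓝 0) := by
    simpa using id0.pow 2
  have lZ1 : Tendsto Z1 (𝓝[>] 0) (𝓝 1) := by
    have : Continuous Z1 := by simp only [hZ1]; fun_prop
    have h := (this.tendsto 0).mono_left (nhdsWithin_le_nhds (s := Set.Ioi 0))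
    simpa [hZ1] using h
  have lW1 : Tendsto W1 (𝓝[>] 0) (𝓝 (1 / 2)) := by
    have : Continuous W1 := by simp only [hW1]; fun_prop
    have h := (this.tendsto 0).mono_left (nhdsWithin_le_nhds (s := Set.Ioi 0))
    simpa [hW1] using h
  have lZ : Tendsto Z (𝓝[>] 0) (𝓝 1) := by
    simpa using (dZ.trans_tendsto sq0).add lZ1
  have lW : Tendsto W (𝓝[>] 0) (𝓝 (1 / 2)) := by
    simpa using (dW.trans_tendsto sq0).add lW1
  have hT : Tendsto (fun t => ((Z t, W t), (Z1 t, W1 t))) (𝓝[>] 0)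
      (𝓝 (((1 : ℝ), (1 / 2 : ℝ)), ((1 : ℝ), (1 / 2 : ℝ)))) :=
    (lZ.prodMk_nhds lW).prodMk_nhds (lZ1.prodMk_nhds lW1)
  have key := (aux_strict.isBigO_sub.comp_tendsto hT).trans
    (g := fun t => ((Z t, W t) - (Z1 t, W1 t) : ℝ × ℝ)) (k := fun t : ℝ => t ^ 2)
    (dZ.prod_left dW)
  refine key.congr' ?_ EventuallyEq.rfl
  filter_upwards [lZ.eventually (lt_mem_nhds one_pos), lZ1.eventually (lt_mem_nhds one_pos),
    Ioo_mem_nhdsGT (zero_lt_one' ℝ)] with t hz hz1 ht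
  have h1 := aux_Ha σ hσ q p a b t U hUe M hM hU ht.1.le ht.2.le hz
  have h2 : Real.log (√(2 * π) * σ * Z1 t) = Real.log (√(2 * π) * σ) + Real.log (Z1 t) :=
    Real.log_mul (by positivity) hz1.ne'
  simp only [Function.comp]
  rw [h1, hH₁]
  change _ = _ - (Real.log (√(2 * π) * σ * Z1 t) + (Z1 t)⁻¹ * W1 t)
  rw [h2]
  change _ = Real.log (√(2 * π) * σ) + (Real.log (Z t) + (Z t)⁻¹ * W t) - _
  ring
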